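/- For all reals a₁, a₂ with 0 ≤ a₁ ≤ a₂, a right isosceles (a₁, 0)-hat and a right isosceles (a₂, a₂−a₁)-hat can be packed into a right isosceles (a₁+a₂, 0)-hat, i.e., there exist isometries g₁, g₂ of ℝ² mapping the two hats to subsets of the (a₁+a₂, 0)-hat whose interiors are disjoint. -/

import Mathlib

noncomputable section

abbrev Plane := EuclideanSpace ℝ (Fin 2)

def pt (x y : ℝ) : Plane := (WithLp.equiv 2 (Fin 2 → ℝ)).symm ![x, y]

/-- The union of all closed disks of radius `s` contained in `T`
(`T` with its corners rounded to radius `s`). -/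
def roundCorners (s : ℝ) (T : Set Plane) : Set Plane :=
  ⋃ c ∈ {c : Plane | Metric.closedBall c s ⊆ T}, Metric.closedBall c s

/-- A closed isosceles right triangle whose incircle has area `a`:
right angle at the origin, legs of length `(2+√2)·√(a/π)` along the axes. -/
def rightIsoTriangle (a : ℝ) : Set Plane :=
  convexHull ℝ {pt 0 0, pt ((2 + Real.sqrt 2) * Real.sqrt (a / Real.pi)) 0,
    pt 0 ((2 + Real.sqrt 2) * Real.sqrt (a / Real.pi))}

/-- The right isosceles `(a,b)`-hat: the isosceles right triangle with incircle area `a`,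
with its corners rounded to the radius `√(b/π)` of a circle of area `b`. -/
def rightIsoHat (a b : ℝ) : Set Plane :=
  roundCorners (Real.sqrt (b / Real.pi)) (rightIsoTriangle a)

theorem roundCorners_zero (T : Set Plane) : roundCorners 0 T = T := by
  ext x
  simp [roundCorners]

theorem roundCorners_subset (s : ℝ) (T : Set Plane) : roundCorners s T ⊆ T :=
  Set.iUnion₂_subset fun _ hc => hc

@[simp] theorem pt_apply_zero (x y : ℝ) : pt x y 0 = x := rfl

@[simp] theorem pt_apply_one (x y : ℝ) : pt x y 1 = y := rfl

theorem plane_ext {z w : Plane} (h0 : z 0 = w 0) (h1 : z 1 = w 1) : z = w := by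
  ext i
  fin_cases i
  · exact h0
  · exact h1

theorem plane_dist_eq (z w : Plane) :
    dist z w = √((z 0 - w 0) ^ 2 + (z 1 - w 1) ^ 2) := by
  simp [EuclideanSpace.dist_eq, Fin.sum_univ_two, Real.dist_eq, sq_abs]

theorem mem_closedBall_iff_sq_le {z c : Plane} {s : ℝ} (hs : 0 ≤ s) :
    z ∈ Metric.closedBall c s ↔ (z 0 - c 0) ^ 2 + (z 1 - c 1) ^ 2 ≤ s ^ 2 := by
  rw [Metric.mem_closedBall, plane_dist_eq, Real.sqrt_le_left hs]

/-- The leg length of the isosceles right triangle with incircle area `a`. -/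
def legLength (a : ℝ) : ℝ := (2 + √2) * √(a / Real.pi)

theorem legLength_nonneg (a : ℝ) : 0 ≤ legLength a := by
  unfold legLength
  positivity

theorem mem_convexHull_right_triangle_iff {l : ℝ} (hl : 0 ≤ l) (z : Plane) :
    z ∈ convexHull ℝ {pt 0 0, pt l 0, pt 0 l} ↔ 0 ≤ z 0 ∧ 0 ≤ z 1 ∧ z 0 + z 1 ≤ l := by
  constructor
  · intro hz
    have hconv : Convex ℝ {w : Plane | 0 ≤ w 0 ∧ 0 ≤ w 1 ∧ w 0 + w 1 ≤ l} := by
      rintro x ⟨hx0, hx1, hx2⟩ y ⟨hy0, hy1, hy2⟩ a b ha hb hab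
      simp only [Set.mem_ofPred_eq, PiLp.add_apply, PiLp.smul_apply, smul_eq_mul]
      refine ⟨by positivity, by positivity, ?_⟩
      have hb' : b = 1 - a := by linarith
      subst hb'
      nlinarith
    refine convexHull_min ?_ hconv hz
    rintro w (rfl | rfl | rfl) <;> simp [hl]
  · rintro ⟨h0, h1, h2⟩
    rcases hl.eq_or_lt with rfl | hl
    · refine subset_convexHull ℝ _ (Or.inl (plane_ext ?_ ?_))
      · rw [pt_apply_zero]; linarith
      · rw [pt_apply_one]; linarith
    · have hcomb : z = (1 - (z 0 + z 1) / l) • pt 0 0 +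
          ((z 0 / l) • pt l 0 + (z 1 / l) • pt 0 l) := by
        apply plane_ext <;> simp [hl.ne']
      rw [hcomb]
      set S : Set Plane := {pt 0 0, pt l 0, pt 0 l}
      have hsum := (convex_convexHull ℝ S).sum_mem (t := Finset.univ)
        (w := ![1 - (z 0 + z 1) / l, z 0 / l, z 1 / l]) (z := ![pt 0 0, pt l 0, pt 0 l])
        (by
          intro i _
          have := (div_le_one hl).2 h2
          fin_cases i
          · simpa using this
          · exact div_nonneg h0 hl.le
          · exact div_nonneg h1 hl.le)
        (by simp [Fin.sum_univ_three]; ring)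
        (by intro i _; fin_cases i <;> exact subset_convexHull ℝ S (by simp [S]))
      simpa [Fin.sum_univ_three, add_assoc] using hsum

theorem mem_rightIsoTriangle_iff (a : ℝ) (z : Plane) :
    z ∈ rightIsoTriangle a ↔ 0 ≤ z 0 ∧ 0 ≤ z 1 ∧ z 0 + z 1 ≤ legLength a :=
  mem_convexHull_right_triangle_iff (legLength_nonneg a) z

/-- The centres of the disks of radius `s` contained in a right triangle lie at distance at
least `s` from the vertical leg and the hypotenuse. -/
theorem center_bounds_of_closedBall_subset {a s : ℝ} (hs : 0 ≤ s) {c : Plane}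
    (hc : Metric.closedBall c s ⊆ rightIsoTriangle a) :
    s ≤ c 0 ∧ c 0 + c 1 + √2 * s ≤ legLength a := by
  have h2 : √2 ^ 2 = 2 := Real.sq_sqrt (by norm_num)
  have left := hc ((mem_closedBall_iff_sq_le (z := pt (c 0 - s) (c 1)) hs).2 (by simp))
  have diag := hc ((mem_closedBall_iff_sq_le
    (z := pt (c 0 + √2 / 2 * s) (c 1 + √2 / 2 * s)) hs).2 (by
      simp only [pt_apply_zero, pt_apply_one]
      apply le_of_eq
      linear_combination s ^ 2 / 2 * h2))
  rw [mem_rightIsoTriangle_iff] at left diag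
  simp only [pt_apply_zero, pt_apply_one] at left diag
  constructor <;> linarith [left.1, diag.2.2]

/-- Rounding the corners bounds a hat in the direction `(-1, 1)`. -/
theorem sub_le_of_mem_roundCorners {a s : ℝ} (hs : 0 ≤ s) {z : Plane}
    (hz : z ∈ roundCorners s (rightIsoTriangle a)) :
    z 1 - z 0 ≤ legLength a - 2 * s := by
  obtain ⟨c, hc, hzc⟩ := Set.mem_iUnion₂.1 hz
  obtain ⟨h0, h1⟩ := center_bounds_of_closedBall_subset hs hc
  rw [mem_closedBall_iff_sq_le hs] at hzc
  have h2 : √2 ^ 2 = 2 := Real.sq_sqrt (by norm_num)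
  have hdir : (z 1 - c 1) - (z 0 - c 0) ≤ √2 * s := by
    refine le_of_pow_le_pow_left₀ two_ne_zero (by positivity) ?_
    rw [mul_pow, h2]
    nlinarith [sq_nonneg ((z 1 - c 1) + (z 0 - c 0))]
  linarith

/-- The isometry sending a point with coordinates `(p, q)` to the point at position `c + e * p`
along the hypotenuse (oriented from `(0, L)` to `(L, 0)`) of the right triangle with legs `L`,
and at height `q` above that hypotenuse. -/
def hypotenuseFrame (L c e : ℝ) (he : e * e = 1) : Plane ≃ᵢ Plane :=
  IsometryEquiv.mk'
    (fun z => pt (√2 / 2 * (c + e * z 0 - z 1)) (L - √2 / 2 * (c + e * z 0 + z 1)))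
    (fun w => pt (e * (√2 / 2 * (w 0 + L - w 1) - c)) (√2 / 2 * (L - w 1 - w 0)))
    (fun w => by
      have h2 : √2 ^ 2 = 2 := Real.sq_sqrt (by norm_num)
      apply plane_ext
      · simp only [pt_apply_zero, pt_apply_one]
        linear_combination √2 / 2 * (√2 / 2 * (w 0 + L - w 1) - c) * he + w 0 / 2 * h2
      · simp only [pt_apply_zero, pt_apply_one]
        linear_combination - √2 / 2 * (√2 / 2 * (w 0 + L - w 1) - c) * he - (L - w 1) / 2 * h2)
    (Isometry.of_dist_eq fun z w => by
      have h2 : √2 ^ 2 = 2 := Real.sq_sqrt (by norm_num)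
      rw [plane_dist_eq, plane_dist_eq]
      congr 1
      simp only [pt_apply_zero, pt_apply_one]
      linear_combination (z 0 - w 0) ^ 2 * √2 ^ 2 / 2 * he
        + ((z 0 - w 0) ^ 2 + (z 1 - w 1) ^ 2) / 2 * h2)

@[simp] theorem hypotenuseFrame_apply (L c e : ℝ) (he : e * e = 1) (z : Plane) :
    hypotenuseFrame L c e he z =
      pt (√2 / 2 * (c + e * z 0 - z 1)) (L - √2 / 2 * (c + e * z 0 + z 1)) :=
  rfl

theorem hypotenuseFrame_mem_rightIsoTriangle {a c e : ℝ} (he : e * e = 1) {z : Plane}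
    (h1 : 0 ≤ z 1) (hle : z 1 ≤ c + e * z 0) (hadd : c + e * z 0 + z 1 ≤ √2 * legLength a) :
    hypotenuseFrame (legLength a) c e he z ∈ rightIsoTriangle a := by
  have h2 : √2 ^ 2 = 2 := Real.sq_sqrt (by norm_num)
  have hpos : 0 ≤ √2 / 2 := by positivity
  rw [mem_rightIsoTriangle_iff, hypotenuseFrame_apply, pt_apply_zero, pt_apply_one]
  refine ⟨mul_nonneg hpos (by linarith), ?_, ?_⟩
  · have := mul_le_mul_of_nonneg_left hadd hpos
    linear_combination this + legLength a / 2 * h2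
  · linarith [mul_nonneg hpos h1]

/-- Sets on opposite sides of a line of slope one have disjoint interiors. -/
theorem disjoint_interior_of_sub_le {S₁ S₂ : Set Plane} {m : ℝ}
    (h₁ : ∀ z ∈ S₁, m ≤ z 0 - z 1) (h₂ : ∀ z ∈ S₂, z 0 - z 1 ≤ m) :
    Disjoint (interior S₁) (interior S₂) := by
  rw [Set.disjoint_left]
  intro z hz₁ hz₂
  have hz : z ∈ interior (S₁ ∩ S₂) := by rw [interior_inter]; exact ⟨hz₁, hz₂⟩
  obtain ⟨ε, hε, hball⟩ := Metric.mem_nhds_iff.1 (mem_interior_iff_mem_nhds.1 hz)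
  have hw : pt (z 0 + ε / 2) (z 1) ∈ Metric.ball z ε := by
    rw [Metric.mem_ball, plane_dist_eq]
    simp only [pt_apply_zero, pt_apply_one, add_sub_cancel_left, sub_self]
    rw [Real.sqrt_lt' hε]
    nlinarith
  have := h₂ _ (hball hw).2
  have := h₁ _ (interior_subset hz₁)
  simp only [pt_apply_zero, pt_apply_one] at *
  linarith

theorem mul_le_add_of_sq_add_sq_eq {r R s : ℝ} (hs : 0 ≤ s) (hrR : r ≤ R) (hR : R ≤ √2 * r)
    (h : R ^ 2 + s ^ 2 = 2 * r ^ 2) : (2 + √2) * r ≤ s + (1 + √2) * R := by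
  have h2 : √2 ^ 2 = 2 := Real.sq_sqrt (by norm_num)
  by_contra! hlt
  have hsq : s ^ 2 < ((2 + √2) * r - (1 + √2) * R) ^ 2 :=
    pow_lt_pow_left₀ (by linarith) hs two_ne_zero
  have hprod : 0 ≤ (4 + 2 * √2) * ((R - r) * (√2 * r - R)) :=
    mul_nonneg (by positivity) (mul_nonneg (by linarith) (by linarith))
  have key : ((2 + √2) * r - (1 + √2) * R) ^ 2 - s ^ 2 =
      - ((4 + 2 * √2) * ((R - r) * (√2 * r - R))) := by
    linear_combination (R ^ 2 - r ^ 2) * h2 - h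
  linarith

/-- A right isosceles `(a₁,0)`-hat and a right isosceles `(a₂,a₂−a₁)`-hat can be packed
into a right isosceles `(a₁+a₂,0)`-hat. -/
theorem right_hats_in_right_hat (a₁ a₂ : ℝ) (h₁ : 0 ≤ a₁) (h₂ : a₁ ≤ a₂) :
    ∃ g₁ g₂ : Plane ≃ᵢ Plane,
      g₁ '' rightIsoHat a₁ 0 ⊆ rightIsoHat (a₁ + a₂) 0 ∧
      g₂ '' rightIsoHat a₂ (a₂ - a₁) ⊆ rightIsoHat (a₁ + a₂) 0 ∧
      Disjoint (interior (g₁ '' rightIsoHat a₁ 0))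
               (interior (g₂ '' rightIsoHat a₂ (a₂ - a₁))) := by
  have hat_zero (a : ℝ) : rightIsoHat a 0 = rightIsoTriangle a := by
    rw [rightIsoHat, zero_div, Real.sqrt_zero, roundCorners_zero]
  rw [hat_zero, hat_zero]
  have hsqrt : √2 ^ 2 = 2 := Real.sq_sqrt (by norm_num)
  have hpi := Real.pi_pos
  have hr₁ : √(a₁ / Real.pi) ^ 2 = a₁ / Real.pi := Real.sq_sqrt (by positivity)
  have hr₂ : √(a₂ / Real.pi) ^ 2 = a₂ / Real.pi :=
    Real.sq_sqrt (div_nonneg (h₁.trans h₂) hpi.le)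
  have hR : √((a₁ + a₂) / Real.pi) ^ 2 = (a₁ + a₂) / Real.pi :=
    Real.sq_sqrt (div_nonneg (by linarith) hpi.le)
  have hs : √((a₂ - a₁) / Real.pi) ^ 2 = (a₂ - a₁) / Real.pi :=
    Real.sq_sqrt (div_nonneg (by linarith) hpi.le)
  have hle : legLength a₁ ≤ legLength a₂ := by
    unfold legLength
    gcongr
  have hsum : legLength a₁ + legLength a₂ ≤ √2 * legLength (a₁ + a₂) := by
    have key : √(a₁ / Real.pi) + √(a₂ / Real.pi) ≤ √2 * √((a₁ + a₂) / Real.pi) := by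
      refine le_of_pow_le_pow_left₀ two_ne_zero (by positivity) ?_
      rw [mul_pow, hsqrt, hR, add_div]
      nlinarith [sq_nonneg (√(a₁ / Real.pi) - √(a₂ / Real.pi))]
    unfold legLength
    have := mul_le_mul_of_nonneg_left key (by positivity : 0 ≤ 2 + √2)
    linarith
  have hround : 2 * legLength a₂ - 2 * √((a₂ - a₁) / Real.pi) ≤ √2 * legLength (a₁ + a₂) := by
    have key := mul_le_add_of_sq_add_sq_eq (Real.sqrt_nonneg ((a₂ - a₁) / Real.pi))
      (Real.sqrt_le_sqrt (by gcongr; linarith) : √(a₂ / Real.pi) ≤ √((a₁ + a₂) / Real.pi))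
      (by
        refine le_of_pow_le_pow_left₀ two_ne_zero (by positivity) ?_
        rw [mul_pow, hsqrt, hR, hr₂, ← mul_div_assoc]
        gcongr
        linarith)
      (by rw [hR, hs, hr₂]; ring)
    unfold legLength
    linear_combination 2 * key - √((a₁ + a₂) / Real.pi) * hsqrt
  set L := legLength (a₁ + a₂)
  refine ⟨hypotenuseFrame L (√2 * L - legLength a₁) 1 (by norm_num),
    hypotenuseFrame L (legLength a₂) (-1) (by norm_num), ?_, ?_, ?_⟩
  · rintro _ ⟨z, hz, rfl⟩
    rw [mem_rightIsoTriangle_iff] at hz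
    obtain ⟨hz0, hz1, hz2⟩ := hz
    have := legLength_nonneg a₂
    exact hypotenuseFrame_mem_rightIsoTriangle _ hz1 (by linarith) (by linarith)
  · rintro _ ⟨z, hz, rfl⟩
    have hsub := sub_le_of_mem_roundCorners (Real.sqrt_nonneg _) hz
    obtain ⟨hz0, hz1, hz2⟩ := (mem_rightIsoTriangle_iff _ _).1 (roundCorners_subset _ _ hz)
    exact hypotenuseFrame_mem_rightIsoTriangle _ hz1 (by linarith) (by linarith)
  · apply disjoint_interior_of_sub_le (m := √2 * legLength a₂ - L)
    · rintro _ ⟨z, hz, rfl⟩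
      obtain ⟨hz0, -, -⟩ := (mem_rightIsoTriangle_iff _ _).1 hz
      rw [hypotenuseFrame_apply, pt_apply_zero, pt_apply_one]
      have : 0 ≤ √2 * (√2 * L - legLength a₁ - legLength a₂ + z 0) :=
        mul_nonneg (by positivity) (by linarith)
      linarith
    · rintro _ ⟨z, hz, rfl⟩
      obtain ⟨hz0, -, -⟩ := (mem_rightIsoTriangle_iff _ _).1 (roundCorners_subset _ _ hz)
      rw [hypotenuseFrame_apply, pt_apply_zero, pt_apply_one]
      have : 0 ≤ √2 * z 0 := by positivity
      linarith
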